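/- arXiv:2102.09047 — 3 statements merged into one kernel-verified Lean document; each statement's English description precedes it below -/
import Mathlib

section
/- Let Q_L, Q_W be symmetric positive definite m×m real matrices and a_L, a_W ∈ ℝ^m, and let θ(t) = (1/2)[tQ_L + (1−t)Q_W]⁻¹[(t−1)a_W − t a_L] be the quadratic trace. Then t ↦ θ(t) is differentiable on (0,1), and with S_L(θ) = −(θᵀQ_Lθ + a_Lᵀθ + c_L), S_W(θ) = −(θᵀQ_Wθ + a_Wᵀθ + c_W), the quadratic trace satisfies the Pareto-trace differential equation ∇²J_t(θ(t)) · θ'(t) = ∇S_W(θ(t)) − ∇S_L(θ(t)) for every t ∈ (0,1), where J_t = (1−t)S_W + t S_L. -/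
open Matrix

theorem qt_grad {m : ℕ} (Q : Matrix (Fin m) (Fin m) ℝ) (hQ : Q.IsHermitian) (a : Fin m → ℝ) (c : ℝ)
    (S : EuclideanSpace ℝ (Fin m) → ℝ)
    (hS : ∀ θ : EuclideanSpace ℝ (Fin m), S θ = -(θ ⬝ᵥ (Q *ᵥ θ) + a ⬝ᵥ θ + c)) :
    gradient S = fun θ => -((2:ℝ) • Matrix.toEuclideanCLM (𝕜 := ℝ) Q θ + WithLp.toLp 2 a) := by
  funext θ
  apply HasGradientAt.gradient
  rw [hasGradientAt_iff_hasFDerivAt]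
  have hS' : S = fun θ => -(inner ℝ θ (Matrix.toEuclideanCLM (𝕜 := ℝ) Q θ)
      + inner ℝ (WithLp.toLp 2 a) θ + c) := by
    funext θ
    rw [hS]
    simp [EuclideanSpace.inner_eq_star_dotProduct, dotProduct_comm]
  rw [hS']
  have h1 := (hasFDerivAt_id (𝕜 := ℝ) θ).inner ℝ
    ((Matrix.toEuclideanCLM (𝕜 := ℝ) Q).hasFDerivAt (x := θ))
  have h2 := (hasFDerivAt_const (𝕜 := ℝ) (WithLp.toLp 2 a) θ).inner ℝ (hasFDerivAt_id (𝕜 := ℝ) θ)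
  refine (((h1.add h2).add_const c).neg).congr_fderiv ?_
  ext v
  have hsym : inner ℝ θ (Matrix.toEuclideanCLM (𝕜 := ℝ) Q v)
      = inner ℝ (Matrix.toEuclideanCLM (𝕜 := ℝ) Q θ) v := by
    have h := hQ.eq
    simp only [conjTranspose_eq_transpose_of_trivial] at h
    simp [EuclideanSpace.inner_eq_star_dotProduct]
    rw [dotProduct_comm, dotProduct_mulVec, dotProduct_comm, ← mulVec_transpose, h]
  simp [hsym, real_inner_comm]
  ring

theorem quadratic_trace_satisfies_ode {m : ℕ}
    (QL QW : Matrix (Fin m) (Fin m) ℝ) (hQL : QL.PosDef) (hQW : QW.PosDef)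
    (aL aW : Fin m → ℝ) (cL cW : ℝ)
    (SL SW : EuclideanSpace ℝ (Fin m) → ℝ)
    (hSL : ∀ θ : EuclideanSpace ℝ (Fin m), SL θ = -(θ ⬝ᵥ (QL *ᵥ θ) + aL ⬝ᵥ θ + cL))
    (hSW : ∀ θ : EuclideanSpace ℝ (Fin m), SW θ = -(θ ⬝ᵥ (QW *ᵥ θ) + aW ⬝ᵥ θ + cW))
    (J : ℝ → EuclideanSpace ℝ (Fin m) → ℝ)
    (hJ : ∀ t θ, J t θ = (1 - t) * SW θ + t * SL θ)
    (θtr : ℝ → EuclideanSpace ℝ (Fin m))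
    (hθtr : ∀ t, θtr t
      = (1 / 2 : ℝ) • ((t • QL + (1 - t) • QW)⁻¹ *ᵥ ((t - 1) • aW - t • aL))) :
    DifferentiableOn ℝ θtr (Set.Ioo (0 : ℝ) 1) ∧
      ∀ t ∈ Set.Ioo (0 : ℝ) 1,
        fderiv ℝ (gradient (J t)) (θtr t) (deriv θtr t)
          = gradient SW (θtr t) - gradient SL (θtr t) := by
  set T := Matrix.toEuclideanCLM (𝕜 := ℝ) (n := Fin m) with hT
  let A : ℝ → EuclideanSpace ℝ (Fin m) →L[ℝ] EuclideanSpace ℝ (Fin m) :=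
    fun t => t • T QL + (1 - t) • T QW
  let b : ℝ → EuclideanSpace ℝ (Fin m) :=
    fun t => (t - 1) • WithLp.toLp 2 aW - t • WithLp.toLp 2 aL
  have hpos : ∀ t ∈ Set.Ioo (0 : ℝ) 1, (t • QL + (1 - t) • QW).PosDef := fun t ht =>
    (hQL.smul ht.1).add (hQW.smul (sub_pos.2 ht.2))
  have hAT : ∀ t, A t = T (t • QL + (1 - t) • QW) := fun t => by simp [A]
  have hunit : ∀ t ∈ Set.Ioo (0 : ℝ) 1, IsUnit (A t) := fun t ht => by
    rw [hAT]; exact (hpos t ht).isUnit.map T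
  have hθ : ∀ t ∈ Set.Ioo (0 : ℝ) 1, θtr t = (1 / 2 : ℝ) • (Ring.inverse (A t)) (b t) := by
    intro t ht
    have hdet : IsUnit (t • QL + (1 - t) • QW).det := (isUnit_iff_isUnit_det _).1 (hpos t ht).isUnit
    have : Ring.inverse (A t) = T ((t • QL + (1 - t) • QW)⁻¹) := by
      apply (hunit t ht).mul_left_cancel
      rw [Ring.mul_inverse_cancel _ (hunit t ht), hAT, ← map_mul, mul_nonsing_inv _ hdet, map_one]
    rw [this]
    apply WithLp.ofLp_injective
    rw [hθtr]
    simp [T, b, mulVec_sub, mulVec_smul]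
  have hA : ∀ t, HasDerivAt A (T QL - T QW) t := fun t => by
    have := ((hasDerivAt_id t).smul_const (T QL)).add
      (((hasDerivAt_id t).const_sub 1).smul_const (T QW))
    refine this.congr_deriv ?_
    simp [sub_eq_add_neg]
  have hb : ∀ t, HasDerivAt b (WithLp.toLp 2 aW - WithLp.toLp 2 aL) t := fun t => by
    have := (((hasDerivAt_id t).sub_const 1).smul_const (WithLp.toLp 2 aW)).sub
      ((hasDerivAt_id t).smul_const (WithLp.toLp 2 aL))
    refine this.congr_deriv ?_
    simp
  have hdiff : ∀ t ∈ Set.Ioo (0 : ℝ) 1, DifferentiableAt ℝ θtr t := by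
    intro t ht
    have h1 : DifferentiableAt ℝ (fun t => (1 / 2 : ℝ) • (Ring.inverse (A t)) (b t)) t := by
      have h2 : DifferentiableAt ℝ (fun t => Ring.inverse (A t)) t :=
        (differentiableAt_inverse (𝕜 := ℝ) (hunit t ht)).comp t (hA t).differentiableAt
      exact (h2.clm_apply (hb t).differentiableAt).const_smul (1 / 2 : ℝ)
    refine h1.congr_of_eventuallyEq ?_
    filter_upwards [isOpen_Ioo.mem_nhds ht] with s hs using hθ s hs
  refine ⟨fun t ht => (hdiff t ht).differentiableWithinAt, fun t ht => ?_⟩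
  have hJg := qt_grad (t • QL + (1 - t) • QW) (hpos t ht).isHermitian (t • aL + (1 - t) • aW)
    (t * cL + (1 - t) * cW) (J t) (fun θ => by
      rw [hJ, hSL, hSW]
      simp [add_mulVec, smul_mulVec, dotProduct_add, add_dotProduct]
      ring)
  have hF : HasFDerivAt (gradient (J t)) (-((2:ℝ) • A t)) (θtr t) := by
    rw [hJg, hAT]
    exact (((T (t • QL + (1 - t) • QW)).hasFDerivAt.const_smul (2:ℝ)).add_const _).neg
  rw [hF.fderiv, qt_grad QL hQL.isHermitian aL cL SL hSL, qt_grad QW hQW.isHermitian aW cW SW hSW]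
  have e1 := (hA t).clm_apply (hdiff t ht).hasDerivAt
  have e2 : HasDerivAt (fun s => A s (θtr s))
      ((1 / 2 : ℝ) • (WithLp.toLp 2 aW - WithLp.toLp 2 aL)) t := by
    refine ((hb t).const_smul (1 / 2 : ℝ)).congr_of_eventuallyEq ?_
    filter_upwards [isOpen_Ioo.mem_nhds ht] with s hs
    rw [hθ s hs, map_smul, ← mul_apply_eq_comp, Ring.mul_inverse_cancel _ (hunit s hs)]
    rfl
  have e := e1.unique e2
  have e' : A t (deriv θtr t) = (1 / 2 : ℝ) • (WithLp.toLp 2 aW - WithLp.toLp 2 aL)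
      - (T QL - T QW) (θtr t) := by rw [← e]; abel
  simp only [_root_.neg_apply, _root_.smul_apply, e',
    _root_.sub_apply]
  module
end

section
/- Let D ⊂ ℝ^m be an open convex set, S : D → ℝ differentiable, and W_r ∈ ℝ^{m×r}. Then S is a ridge function over W_r — i.e., there exists H : ℝ^r → ℝ with S(θ) = H(W_rᵀθ) for all θ ∈ D — if and only if the directional derivative dS_θ[w] = wᵀ∇S(θ) equals 0 for every θ ∈ D and every w ∈ Null(W_rᵀ). -/
open Matrix

/-- On an open convex domain `D`, a differentiable function `S` is a ridge
function over `W_r` (i.e. `S(θ) = H(W_rᵀθ)` for some `H`) if and only if its directional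
derivative `wᵀ∇S(θ)` vanishes for every `θ ∈ D` and every `w ∈ Null(W_rᵀ)`. -/
theorem ridge_function_iff_inactive_derivative_zero {m r : ℕ}
    (D : Set (Fin m → ℝ)) (hDo : IsOpen D) (hDc : Convex ℝ D)
    (S : (Fin m → ℝ) → ℝ) (hS : ∀ θ ∈ D, DifferentiableAt ℝ S θ)
    (Wr : Matrix (Fin m) (Fin r) ℝ) :
    (∃ H : (Fin r → ℝ) → ℝ, ∀ θ ∈ D, S θ = H (Wrᵀ *ᵥ θ)) ↔
      (∀ θ ∈ D, ∀ w : Fin m → ℝ, Wrᵀ *ᵥ w = 0 → fderiv ℝ S θ w = 0) := by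
  constructor
  · rintro ⟨H, hH⟩ θ hθ w hw
    have h1 : HasDerivAt (fun t : ℝ => S (θ + t • w)) (fderiv ℝ S θ w) 0 :=
      (hS θ hθ).hasFDerivAt.hasLineDerivAt w
    have hc : Continuous (fun t : ℝ => θ + t • w) := by fun_prop
    have hev : ∀ᶠ t : ℝ in nhds 0, θ + t • w ∈ D :=
      hc.continuousAt.eventually_mem (hDo.mem_nhds (by simpa using hθ))
    have h2 : (fun t : ℝ => S (θ + t • w)) =ᶠ[nhds 0] fun _ => S θ := by
      filter_upwards [hev] with t ht
      rw [hH _ ht, hH _ hθ, Matrix.mulVec_add, Matrix.mulVec_smul, hw, smul_zero, add_zero]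
    exact h1.unique ((hasDerivAt_const (0 : ℝ) (S θ)).congr_of_eventuallyEq h2)
  · intro h
    have key : ∀ x ∈ D, ∀ y ∈ D, Wrᵀ *ᵥ x = Wrᵀ *ᵥ y → S y = S x := by
      intro x hx y hy hxy
      obtain ⟨z, hz, hzz⟩ := domain_mvt
        (fun z hz => (hS z hz).hasFDerivAt.hasFDerivWithinAt) hDc hx hy
      rw [h z (hDc.segment_subset hx hy hz) (y - x)
        (by rw [Matrix.mulVec_sub, hxy, sub_self])] at hzz
      linarith
    classical
    refine ⟨fun v => if hv : ∃ x ∈ D, Wrᵀ *ᵥ x = v then S hv.choose else 0, ?_⟩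
    intro θ hθ
    have hv : ∃ x ∈ D, Wrᵀ *ᵥ x = Wrᵀ *ᵥ θ := ⟨θ, hθ, rfl⟩
    simp only [dif_pos hv]
    exact key _ hv.choose_spec.1 _ hθ hv.choose_spec.2
end

section
/- Let Q_L, Q_W be symmetric positive definite m×m real matrices and a_L, a_W ∈ ℝ^m, c_L, c_W ∈ ℝ, and define S_L(θ) = −(θᵀQ_Lθ + a_Lᵀθ + c_L) and S_W(θ) = −(θᵀQ_Wθ + a_Wᵀθ + c_W). Then for every t ∈ (0,1), the quadratic trace point θ(t) = (1/2)[tQ_L + (1−t)Q_W]⁻¹[(t−1)a_W − t a_L] is Pareto optimal for the pair (S_L, S_W) over ℝ^m: there is no θ ∈ ℝ^m with S_L(θ) ≥ S_L(θ(t)) and S_W(θ) ≥ S_W(θ(t)) such that at least one inequality is strict. -/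
open Matrix

/-- For every `t ∈ (0,1)`, the quadratic trace point
`θ(t) = (1/2)[tQ_L+(1−t)Q_W]⁻¹[(t−1)a_W − t a_L]` is Pareto optimal for the pair of
concave quadratic objectives `(S_L, S_W)` over `ℝ^m`. -/
theorem quadratic_trace_pareto_optimal {m : ℕ}
    (QL QW : Matrix (Fin m) (Fin m) ℝ) (hQL : QL.PosDef) (hQW : QW.PosDef)
    (aL aW : Fin m → ℝ) (cL cW : ℝ)
    (SL SW : (Fin m → ℝ) → ℝ)
    (hSL : ∀ θ, SL θ = -(θ ⬝ᵥ (QL *ᵥ θ) + aL ⬝ᵥ θ + cL))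
    (hSW : ∀ θ, SW θ = -(θ ⬝ᵥ (QW *ᵥ θ) + aW ⬝ᵥ θ + cW))
    (θtr : ℝ → Fin m → ℝ)
    (hθtr : ∀ t, θtr t
      = (1 / 2 : ℝ) • ((t • QL + (1 - t) • QW)⁻¹ *ᵥ ((t - 1) • aW - t • aL))) :
    ∀ t ∈ Set.Ioo (0 : ℝ) 1,
      ¬ ∃ θ : Fin m → ℝ,
        (SL (θtr t) ≤ SL θ ∧ SW (θtr t) ≤ SW θ) ∧
          (SL (θtr t) < SL θ ∨ SW (θtr t) < SW θ) := by
  rintro t ⟨ht0, ht1⟩ ⟨θ, ⟨h1, h2⟩, h3⟩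
  have ht1' : 0 < 1 - t := by linarith
  have hM : (t • QL + (1 - t) • QW).PosDef := (hQL.smul ht0).add (hQW.smul ht1')
  have hdet : IsUnit (t • QL + (1 - t) • QW).det := hM.det_pos.ne'.isUnit
  have hx : (t • QL + (1 - t) • QW) *ᵥ θtr t = (1 / 2 : ℝ) • ((t - 1) • aW - t • aL) := by
    rw [hθtr, mulVec_smul, mulVec_mulVec, Matrix.mul_nonsing_inv _ hdet, one_mulVec]
  generalize θtr t = x at *
  obtain ⟨d, rfl⟩ : ∃ d, θ = x + d := ⟨θ - x, by simp⟩
  have sym : ∀ Q : Matrix (Fin m) (Fin m) ℝ, Q.PosDef → x ⬝ᵥ (Q *ᵥ d) = d ⬝ᵥ (Q *ᵥ x) := by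
    intro Q hQ
    have hT : Qᵀ = Q := by simpa using hQ.isHermitian.eq
    rw [dotProduct_mulVec, ← mulVec_transpose, hT, dotProduct_comm]
  have psd : ∀ Q : Matrix (Fin m) (Fin m) ℝ, Q.PosDef → 0 ≤ d ⬝ᵥ (Q *ᵥ d) := by
    intro Q hQ
    simpa using hQ.posSemidef.dotProduct_mulVec_nonneg d
  have hk := congrArg (fun v => d ⬝ᵥ v) hx
  simp only [add_mulVec, smul_mulVec, dotProduct_add, dotProduct_smul, dotProduct_sub,
    smul_eq_mul] at hk
  have e1 := mul_nonneg ht0.le (psd QL hQL)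
  have e2 := mul_nonneg ht1'.le (psd QW hQW)
  simp only [hSL, hSW, mulVec_add, dotProduct_add, add_dotProduct, sym QL hQL, sym QW hQW,
    dotProduct_comm aL d, dotProduct_comm aW d] at h1 h2 h3
  rcases h3 with h3 | h3
  · nlinarith [mul_lt_mul_of_pos_left h3 ht0, mul_le_mul_of_nonneg_left h2 ht1'.le]
  · nlinarith [mul_le_mul_of_nonneg_left h1 ht0.le, mul_lt_mul_of_pos_left h3 ht1']
end
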